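/- Consider an n-job coupled-task instance in which all jobs have the same delay time L and each job's two tasks have equal processing time (a_j = b_j = p_j for all j). Then for every pair of feasible schedules σ₁, σ₂ there exists a feasible schedule σ with makespan max_j C_j(σ) ≤ 3 · max_j C_j(σ₁) and total completion time ∑_{j=1}^{n} C_j(σ) ≤ 3 · ∑_{j=1}^{n} C_j(σ₂); in particular some feasible schedule is simultaneously a 3-approximation for the minimum makespan and a 3-approximation for the minimum total completion time. -/

import Mathlib

open Finset

/-- The interval occupied by the first task of job `j`. -/
def task1 (a S : ℕ → ℝ) (j : ℕ) : Set ℝ := Set.Ico (S j) (S j + a j)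

/-- The interval occupied by the second task of job `j`. -/
def task2 (a L b S : ℕ → ℝ) (j : ℕ) : Set ℝ :=
  Set.Ico (S j + a j + L j) (S j + a j + L j + b j)

/-- A schedule `S` for the `n`-job coupled-task instance `(a, L, b)` is feasible if all start
times are nonnegative and the `2n` task intervals are pairwise disjoint. -/
def Feasible (n : ℕ) (a L b S : ℕ → ℝ) : Prop :=
  (∀ j, j < n → 0 ≤ S j) ∧
  (∀ i, i < n → ∀ j, j < n → i ≠ j → Disjoint (task1 a S i) (task1 a S j)) ∧
  (∀ i, i < n → ∀ j, j < n → i ≠ j → Disjoint (task2 a L b S i) (task2 a L b S j)) ∧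
  (∀ i, i < n → ∀ j, j < n → Disjoint (task1 a S i) (task2 a L b S j))

/-- The completion time of job `j` in schedule `S`. -/
def cTime (a L b S : ℕ → ℝ) (j : ℕ) : ℝ := S j + a j + L j + b j

/-- The total completion time of schedule `S`. -/
def totalC (n : ℕ) (a L b S : ℕ → ℝ) : ℝ := ∑ j ∈ Finset.range n, cTime a L b S j

/-- Two nonempty half-open intervals are disjoint iff one ends before the other starts. -/
theorem disj_iff {a b c d : ℝ} (h : a < b) (h' : c < d) :
    Disjoint (Set.Ico a b) (Set.Ico c d) ↔ b ≤ c ∨ d ≤ a := by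
  rw [Set.Ico_disjoint_Ico, min_le_iff, le_max_iff, le_max_iff]
  constructor
  · rintro ((h1 | h1) | (h1 | h1))
    · linarith
    · exact Or.inl h1
    · exact Or.inr h1
    · linarith
  · rintro (h1 | h1)
    · exact Or.inl (Or.inr h1)
    · exact Or.inr (Or.inl h1)

/-- Bi-objective `(3,3)`-approximation for `1|(p_j, L, p_j)|(C_max, ∑ C_j)`: for any two
feasible schedules `S₁`, `S₂` there is a feasible schedule whose makespan is at most `3` times
the makespan of `S₁` and whose total completion time is at most `3` times the total completion
time of `S₂`. -/
theorem biobjective_three_three_common_delay_equal_tasks (n : ℕ) (hn : 0 < n)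
    (p : ℕ → ℝ) (L : ℝ) (hp : ∀ j, j < n → 0 < p j) (hL : 0 ≤ L)
    (S₁ S₂ : ℕ → ℝ)
    (h₁ : Feasible n p (fun _ => L) p S₁) (h₂ : Feasible n p (fun _ => L) p S₂) :
    ∃ S : ℕ → ℝ, Feasible n p (fun _ => L) p S ∧
      (∀ j, j < n → cTime p (fun _ => L) p S j ≤
        3 * (Finset.range n).sup' (Finset.nonempty_range_iff.mpr hn.ne')
          (cTime p (fun _ => L) p S₁)) ∧
      totalC n p (fun _ => L) p S ≤ 3 * totalC n p (fun _ => L) p S₂ := by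
  set T := (Finset.range n).sup' (Finset.nonempty_range_iff.mpr hn.ne')
    (cTime p (fun _ => L) p S₁) with hT
  have hle : ∀ j, j < n → S₁ j + p j + L + p j ≤ T := fun j hj =>
    Finset.le_sup' (cTime p (fun _ => L) p S₁) (Finset.mem_range.mpr hj)
  clear_value T
  obtain ⟨p1, q1, r1, t1⟩ := h₁
  obtain ⟨p2, q2, r2, t2⟩ := h₂
  have hT0 : 0 ≤ T := by
    have := hle 0 hn
    have := p1 0 hn
    have := hp 0 hn
    linarith
  classical
  let S : ℕ → ℝ := fun j => if S₂ j + p j + L + p j ≤ T then S₂ j else T + S₁ j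
  have hS : ∀ j, (S₂ j + p j + L + p j ≤ T ∧ S j = S₂ j) ∨
      (T < S₂ j + p j + L + p j ∧ S j = T + S₁ j) := by
    intro j
    by_cases h : S₂ j + p j + L + p j ≤ T
    · exact Or.inl ⟨h, if_pos h⟩
    · exact Or.inr ⟨not_le.mp h, if_neg h⟩
  clear_value S
  refine ⟨S, ⟨?_, ?_, ?_, ?_⟩, ?_, ?_⟩
  · intro j hj
    have := p1 j hj
    have := p2 j hj
    rcases hS j with ⟨_, h⟩ | ⟨_, h⟩ <;> linarith
  · intro i hi j hj hij
    have a1 := q1 i hi j hj hij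
    have a2 := q2 i hi j hj hij
    have := hp i hi
    have := hp j hj
    have := p1 i hi
    have := p1 j hj
    simp only [task1] at a1 a2 ⊢
    rw [disj_iff (by linarith) (by linarith)] at a1 a2 ⊢
    rcases hS i with ⟨_, h⟩ | ⟨_, h⟩ <;> rcases hS j with ⟨_, h'⟩ | ⟨_, h'⟩ <;> rw [h, h']
    · exact a2
    · left; linarith
    · right; linarith
    · rcases a1 with a | a
      · left; linarith
      · right; linarith
  · intro i hi j hj hij
    have a1 := r1 i hi j hj hij
    have a2 := r2 i hi j hj hij
    have := hp i hi
    have := hp j hj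
    have := p1 i hi
    have := p1 j hj
    simp only [task2] at a1 a2 ⊢
    rw [disj_iff (by linarith) (by linarith)] at a1 a2 ⊢
    rcases hS i with ⟨_, h⟩ | ⟨_, h⟩ <;> rcases hS j with ⟨_, h'⟩ | ⟨_, h'⟩ <;> rw [h, h']
    · exact a2
    · left; linarith
    · right; linarith
    · rcases a1 with a | a
      · left; linarith
      · right; linarith
  · intro i hi j hj
    have a1 := t1 i hi j hj
    have a2 := t2 i hi j hj
    have := hp i hi
    have := hp j hj
    have := p1 i hi
    have := p1 j hj
    simp only [task1, task2] at a1 a2 ⊢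
    rw [disj_iff (by linarith) (by linarith)] at a1 a2 ⊢
    rcases hS i with ⟨_, h⟩ | ⟨_, h⟩ <;> rcases hS j with ⟨_, h'⟩ | ⟨_, h'⟩ <;> rw [h, h']
    · exact a2
    · left; linarith
    · right; linarith
    · rcases a1 with a | a
      · left; linarith
      · right; linarith
  · intro j hj
    have := hle j hj
    simp only [cTime]
    rcases hS j with ⟨_, h⟩ | ⟨_, h⟩ <;> linarith
  · simp only [totalC]
    rw [Finset.mul_sum]
    apply Finset.sum_le_sum
    intro j hj
    have hj := Finset.mem_range.mp hj
    have := hle j hj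
    have := hp j hj
    have := p2 j hj
    simp only [cTime]
    rcases hS j with ⟨_, h⟩ | ⟨_, h⟩ <;> linarith
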